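/- Let n, m, a, b, c, d, P be positive integers (with b, d, P possibly allowed to be nonnegative) satisfying the two edge-determinant relations n·(a·P + b) − a·m = 1 and m·c − n·(c·P + d) = 1. Let β'_1, β_1, β'_2, β_2 be nonnegative integers and suppose N = n·β'_1 + m·β_1 = m·β'_2 + n·β_2 is positive, and set N_1 = a·β'_1 + (a·P + b)·β_1 and N_2 = c·β_2 + (c·P + d)·β'_2. Then β_1 = 0 and β_2 = 0 if and only if there exists a positive integer λ such that N = λ·n·m, N_1 = λ·a·m, and N_2 = λ·n·(c·P + d). (This is the numerical content of the characterization of the exceptional case (†): the multiplicities N, N_1, N_2 along a satellite rupture divisor and its two predecessors are proportional to those of a curvetta exactly when β_1 = β_2 = 0.) -/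

import Mathlib

/-- (Numerical characterization of the exceptional case `(†)`.)
Let `n, m, a, c` be positive integers and `b, d, P` nonnegative integers satisfying the
edge-determinant relations `n·(a·P + b) − a·m = 1` and `m·c − n·(c·P + d) = 1`.  Let
`β'1, β1, β'2, β2` be nonnegative integers with
`N = n·β'1 + m·β1 = m·β'2 + n·β2 > 0`, and set `N1 = a·β'1 + (a·P + b)·β1`,
`N2 = c·β2 + (c·P + d)·β'2`.  Then `β1 = 0 ∧ β2 = 0` iff there is a positive integer `λ`
with `N = λ·n·m`, `N1 = λ·a·m` and `N2 = λ·n·(c·P + d)`. -/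
theorem exceptional_case_dagger_characterization
    (n m a c b d P : ℕ)
    (hn : 0 < n) (hm : 0 < m) (ha : 0 < a) (hc : 0 < c)
    (hdet1 : n * (a * P + b) = a * m + 1)
    (hdet2 : m * c = n * (c * P + d) + 1)
    (β'1 β1 β'2 β2 N N1 N2 : ℕ)
    (hNa : N = n * β'1 + m * β1)
    (hNb : N = m * β'2 + n * β2)
    (hNpos : 0 < N)
    (hN1 : N1 = a * β'1 + (a * P + b) * β1)
    (hN2 : N2 = c * β2 + (c * P + d) * β'2) :
    (β1 = 0 ∧ β2 = 0) ↔
      ∃ lam : ℕ, 0 < lam ∧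
        N = lam * n * m ∧ N1 = lam * a * m ∧ N2 = lam * n * (c * P + d) := by
  generalize a * P + b = e at *
  generalize c * P + d = q at *
  constructor
  · rintro ⟨rfl, rfl⟩
    have hcop : Nat.Coprime n m := by
      rw [← Nat.isCoprime_iff_coprime]
      exact ⟨e, -a, by push_cast [← Int.natCast_inj] at hdet1; linarith⟩
    have hβ : n * β'1 = m * β'2 := by linarith
    obtain ⟨l, rfl⟩ : n ∣ β'2 := hcop.dvd_of_dvd_mul_left ⟨β'1, hβ.symm⟩
    have hβ'1 : β'1 = m * l := Nat.eq_of_mul_eq_mul_left hn (by linarith)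
    subst hβ'1
    refine ⟨l, Nat.pos_of_ne_zero ?_, by linarith, by linarith, by linarith⟩
    rintro rfl
    simp [hNa] at hNpos
  · rintro ⟨l, -, hN, hl1, hl2⟩
    have h1 : n * N1 = a * N + β1 := by
      rw [hN1, hNa]
      linear_combination β1 * hdet1
    have h2 : m * N2 = q * N + β2 := by
      rw [hN2, hNb]
      linear_combination β2 * hdet2
    rw [hl1, hN] at h1
    rw [hl2, hN] at h2
    constructor <;> linarith
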